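/- For every integer k ≥ 3, every G-invariant homogeneous polynomial of degree 3 + (2g−2)k in ℂ[z₁,z₂,z₃] lies in I·F_{1+(2g−2)(k−1)} + F_{3+(2g−2)(k+1)}, where I·F_{1+(2g−2)(k−1)} denotes the set of sums of products of an element of I with an element of F_{1+(2g−2)(k−1)}. (This is the inductive step by which any Maurer–Cartan solution agreeing with W to leading order is brought to W by successive formal changes of variables in Lemma 4.1.) -/

import Mathlib

open MvPolynomial

/-- The superpotential `W = -z₁z₂z₃ + z₁^{2g+1} + z₂^{2g+1} + z₃^{2g+1}`
of the Landau–Ginzburg mirror to a genus-`g` curve. -/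
noncomputable def superpotential (g : ℕ) : MvPolynomial (Fin 3) ℂ :=
  - (X 0 * X 1 * X 2) + X 0 ^ (2 * g + 1) + X 1 ^ (2 * g + 1) + X 2 ^ (2 * g + 1)

/-- The Jacobian ideal `I` of `W`, generated by the three partial derivatives. -/
noncomputable def jacobianIdeal (g : ℕ) : Ideal (MvPolynomial (Fin 3) ℂ) :=
  Ideal.span {pderiv 0 (superpotential g), pderiv 1 (superpotential g),
    pderiv 2 (superpotential g)}

/-- `Fdeg m` is the ideal of polynomials all of whose nonzero monomials have total
degree at least `m`. -/
noncomputable def Fdeg (m : ℕ) : Ideal (MvPolynomial (Fin 3) ℂ) where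
  carrier := {p | ∀ d ∈ p.support, m ≤ d.sum fun _ e => e}
  zero_mem' := by simp
  add_mem' := by
    intro a b ha hb d hd
    rcases Finset.mem_union.mp (MvPolynomial.support_add hd) with h | h
    · exact ha d h
    · exact hb d h
  smul_mem' := by
    intro c p hp d hd
    rw [smul_eq_mul] at hd
    obtain ⟨d1, _, d2, hd2, rfl⟩ := Finset.mem_add.mp (MvPolynomial.support_mul c p hd)
    have h2 := hp d2 hd2
    have hsum : (d1 + d2).sum (fun _ e => e) =
        d1.sum (fun _ e => e) + d2.sum (fun _ e => e) :=
      Finsupp.sum_add_index' (fun _ => rfl) (fun _ _ _ => rfl)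
    omega

theorem mem_Fdeg_of_isHomogeneous {m d : ℕ} {q : MvPolynomial (Fin 3) ℂ}
    (hq : q.IsHomogeneous d) (hm : m ≤ d) : q ∈ Fdeg m := by
  intro e he
  have h : e.degree = d := by
    by_contra h
    exact mem_support_iff.mp he (hq.coeff_eq_zero h)
  rw [Finsupp.degree_apply] at h
  exact hm.trans h.ge

theorem isHomogeneous_X_pow_mul_X_pow_mul_X_pow (i j l : Fin 3) (a b c : ℕ) :
    (X i ^ a * X j ^ b * X l ^ c : MvPolynomial (Fin 3) ℂ).IsHomogeneous (a + b + c) :=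
  ((isHomogeneous_X_pow i a).mul (isHomogeneous_X_pow j b)).mul (isHomogeneous_X_pow l c)

theorem pderiv_zero_superpotential (g : ℕ) :
    pderiv 0 (superpotential g) = ((2 * g + 1 : ℕ) : MvPolynomial (Fin 3) ℂ) * X 0 ^ (2 * g) - X 1 * X 2 := by
  simp [superpotential, pderiv_X]
  ring

theorem pderiv_one_superpotential (g : ℕ) :
    pderiv 1 (superpotential g) = ((2 * g + 1 : ℕ) : MvPolynomial (Fin 3) ℂ) * X 1 ^ (2 * g) - X 0 * X 2 := by
  simp [superpotential, pderiv_X]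
  ring

theorem pderiv_two_superpotential (g : ℕ) :
    pderiv 2 (superpotential g) = ((2 * g + 1 : ℕ) : MvPolynomial (Fin 3) ℂ) * X 2 ^ (2 * g) - X 0 * X 1 := by
  simp [superpotential, pderiv_X]
  ring

theorem sub_mem_jacobianIdeal (g : ℕ) {i j l : Fin 3} (hij : i ≠ j) (hil : i ≠ l)
    (hjl : j ≠ l) :
    ((2 * g + 1 : ℕ) : MvPolynomial (Fin 3) ℂ) * X i ^ (2 * g) - X j * X l ∈ jacobianIdeal g := by
  have h0 : pderiv 0 (superpotential g) ∈ jacobianIdeal g := Ideal.subset_span (by simp)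
  have h1 : pderiv 1 (superpotential g) ∈ jacobianIdeal g := Ideal.subset_span (by simp)
  have h2 : pderiv 2 (superpotential g) ∈ jacobianIdeal g := Ideal.subset_span (by simp)
  rw [pderiv_zero_superpotential] at h0
  rw [pderiv_one_superpotential] at h1
  rw [pderiv_two_superpotential] at h2
  fin_cases i <;> fin_cases j <;> fin_cases l <;>
    simp_all [mul_comm (X 1 : MvPolynomial (Fin 3) ℂ) (X 0),
      mul_comm (X 2 : MvPolynomial (Fin 3) ℂ) (X 0), mul_comm (X 2 : MvPolynomial (Fin 3) ℂ) (X 1)]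

/-- A monomial involving two distinct variables can be traded, modulo the Jacobian ideal,
for one of degree larger by `2g - 2`. -/
theorem mul_mem_of_two_variables {g r s : ℕ} {i j l : Fin 3} (hij : i ≠ j) (hil : i ≠ l)
    (hjl : j ≠ l) {a b c : ℕ} (hr : r ≤ a + b + c) (hs : s ≤ a + b + c + 2 * g) :
    X i ^ a * X j ^ (b + 1) * X l ^ (c + 1) ∈ jacobianIdeal g * Fdeg r + Fdeg s := by
  have h1 := Ideal.mul_mem_mul (sub_mem_jacobianIdeal g hij hil hjl)
    (mem_Fdeg_of_isHomogeneous (isHomogeneous_X_pow_mul_X_pow_mul_X_pow i j l a b c) hr)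
  have h2 := (Fdeg s).mul_mem_left ((2 * g + 1 : ℕ) : MvPolynomial (Fin 3) ℂ)
    (mem_Fdeg_of_isHomogeneous (isHomogeneous_X_pow_mul_X_pow_mul_X_pow i j l (a + 2 * g) b c)
      (by omega))
  rw [Submodule.add_eq_sup]
  convert Submodule.add_mem_sup (neg_mem h1) h2 using 1
  ring

/-- A high power of a single variable is, modulo the Jacobian ideal, a multiple of a monomial
of the same degree involving two variables. -/
theorem X_pow_mem {g r s : ℕ} {i j l : Fin 3} (hij : i ≠ j) (hil : i ≠ l)
    (hjl : j ≠ l) {a : ℕ} (hr : r ≤ a + 2) (hs : s ≤ a + 4 * g) (hg : 1 ≤ g) :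
    X i ^ (a + 2 + 2 * g) ∈ jacobianIdeal g * Fdeg r + Fdeg s := by
  have h1 := Ideal.mul_mem_mul (sub_mem_jacobianIdeal g hij hil hjl)
    (mem_Fdeg_of_isHomogeneous (isHomogeneous_X_pow_mul_X_pow_mul_X_pow i j l (a + 2) 0 0) hr)
  have h2 := Ideal.mul_mem_mul (sub_mem_jacobianIdeal g hij.symm hjl hil)
    (mem_Fdeg_of_isHomogeneous
      (isHomogeneous_X_pow_mul_X_pow_mul_X_pow i j l (a + 1) 1 0) (m := r) (by omega))
  have h3 := mul_mem_of_two_variables (g := g) (r := r) (s := s) hil.symm hjl.symm hij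
    (a := 0) (b := a) (c := 2 * g) (by omega) (by omega)
  have h4 := add_mem (Submodule.mem_sup_left (T := Fdeg s) (sub_mem h1 h2))
    (Ideal.mul_mem_left _ ((2 * g + 1 : ℕ) : MvPolynomial (Fin 3) ℂ) h3)
  have h5 := Ideal.mul_mem_left _ (C ((2 * g + 1 : ℕ) : ℂ)⁻¹) h4
  have hC : C ((2 * g + 1 : ℕ) : ℂ)⁻¹ * ((2 * g + 1 : ℕ) : MvPolynomial (Fin 3) ℂ) = 1 := by
    rw [← map_natCast (C : ℂ →+* MvPolynomial (Fin 3) ℂ), ← C_mul,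
      inv_mul_cancel₀ (Nat.cast_ne_zero.mpr (by omega)), C_1]
  rw [Submodule.add_eq_sup]
  convert h5 using 1
  linear_combination (-X i ^ (a + 2 + 2 * g)) * hC

/-- Every monomial of degree `3 + (2g-2)k`, invariant or not, satisfies the conclusion. -/
theorem X_pow_mul_X_pow_mul_X_pow_mem {g k : ℕ} (hg : 2 ≤ g) (hk : 2 ≤ k) {a b c : ℕ}
    (h : a + b + c = 3 + (2 * g - 2) * k) :
    X 0 ^ a * X 1 ^ b * X 2 ^ c ∈ jacobianIdeal g * Fdeg (1 + (2 * g - 2) * (k - 1))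
        + Fdeg (3 + (2 * g - 2) * (k + 1)) := by
  obtain ⟨k, rfl⟩ := Nat.exists_eq_add_of_le' hk
  obtain ⟨g, rfl⟩ := Nat.exists_eq_add_of_le' hg
  have e1 : k + 2 - 1 = k + 1 := rfl
  have e2 : 2 * (g + 2) - 2 = 2 * g + 2 := by omega
  rw [e1, e2]
  rw [e2] at h
  have n1 : (2 * g + 2) * (k + 2) = (2 * g + 2) * (k + 1) + (2 * g + 2) := by ring
  have n2 : (2 * g + 2) * (k + 2 + 1) = (2 * g + 2) * (k + 1) + 2 * (2 * g + 2) := by ring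
  have n3 : 1 ≤ (2 * g + 2) * (k + 1) := Nat.mul_pos (by omega) (by omega)
  rw [n2]
  rw [n1] at h
  generalize (2 * g + 2) * (k + 1) = M at *
  have pure_case : ∀ {i j l : Fin 3}, i ≠ j → i ≠ l → j ≠ l → ∀ {d : ℕ},
      d = 3 + (M + (2 * g + 2)) →
      X i ^ d ∈ jacobianIdeal (g + 2) * Fdeg (1 + M) + Fdeg (3 + (M + 2 * (2 * g + 2))) := by
    intro i j l hij hil hjl d hd
    obtain rfl : d = (M - 1) + 2 + 2 * (g + 2) := by omega
    exact X_pow_mem hij hil hjl (by omega) (by omega) (by omega)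
  have mixed_case : ∀ {i j l : Fin 3}, i ≠ j → i ≠ l → j ≠ l → ∀ {a b c : ℕ},
      a + (b + 1) + (c + 1) = 3 + (M + (2 * g + 2)) →
      X i ^ a * X j ^ (b + 1) * X l ^ (c + 1) ∈
        jacobianIdeal (g + 2) * Fdeg (1 + M) + Fdeg (3 + (M + 2 * (2 * g + 2))) :=
    fun hij hil hjl _ _ _ _ => mul_mem_of_two_variables hij hil hjl (by omega) (by omega)
  rcases b with _ | b <;> rcases c with _ | c
  · simpa using pure_case (i := 0) (j := 1) (l := 2) (by decide) (by decide) (by decide)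
      (d := a) (by omega)
  · rcases a with _ | a
    · simpa using pure_case (i := 2) (j := 0) (l := 1) (by decide) (by decide) (by decide)
        (d := c + 1) (by omega)
    · simpa using mixed_case (i := 1) (j := 0) (l := 2) (by decide) (by decide) (by decide)
        (a := 0) (b := a) (c := c) (by omega)
  · rcases a with _ | a
    · simpa using pure_case (i := 1) (j := 0) (l := 2) (by decide) (by decide) (by decide)
        (d := b + 1) (by omega)
    · simpa using mixed_case (i := 2) (j := 0) (l := 1) (by decide) (by decide) (by decide)
        (a := 0) (b := a) (c := b) (by omega)
  · exact mixed_case (by decide) (by decide) (by decide) h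

/-- For every `k ≥ 3`, every `G`-invariant homogeneous polynomial of degree `3+(2g−2)k`
(invariance being under all substitutions `zᵢ ↦ tᵢzᵢ` with `tᵢ^{2g+1} = 1` and
`t₁t₂t₃ = 1`) lies in `I·F_{1+(2g−2)(k−1)} + F_{3+(2g−2)(k+1)}`:
the inductive step of Lemma 4.1. -/
theorem stmt_19 (g : ℕ) (hg : 3 ≤ g) (k : ℕ) (hk : 3 ≤ k)
    (p : MvPolynomial (Fin 3) ℂ)
    (hhom : p.IsHomogeneous (3 + (2 * g - 2) * k))
    (hinv : ∀ t : Fin 3 → ℂ, (∀ i, t i ^ (2 * g + 1) = 1) → t 0 * t 1 * t 2 = 1 →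
      aeval (fun i => C (t i) * X i) p = p) :
    p ∈ jacobianIdeal g * Fdeg (1 + (2 * g - 2) * (k - 1))
        + Fdeg (3 + (2 * g - 2) * (k + 1)) := by
  rw [p.as_sum]
  refine Ideal.sum_mem _ fun d hd => ?_
  have hdeg : d.degree = 3 + (2 * g - 2) * k := by
    by_contra h
    exact mem_support_iff.mp hd (hhom.coeff_eq_zero h)
  rw [Finsupp.degree_eq_sum, Fin.sum_univ_three] at hdeg
  rw [monomial_eq, Finsupp.prod_fintype _ _ (by simp), Fin.prod_univ_three]
  exact Ideal.mul_mem_left _ _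
    (X_pow_mul_X_pow_mul_X_pow_mem (by omega) (by omega) hdeg)
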